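/- arXiv:2512.11570 — 2 statements merged into one kernel-verified Lean document; each statement's English description precedes it below -/
import Mathlib

section
/- Assume the smooth endpoint setup on ℝⁿ and the pathwise trajectory hypothesis. Then ∫_{Γ₀} exp(+β [W*(x₀) + Q*(x₀) − II*(x₀)]) dP₀(x₀) = exp(+β ΔF*); in particular the left-hand side is finite. (Heat–work–feedback representation of the endpoint equality, positive-exponent form, Eq. (46).) -/
open MeasureTheory Set

/-- The derivative of a `C¹` function along a continuous path, paired with a continuous vector
field along the path, is continuous in time. -/
theorem ContDiff.continuousOn_fderiv_apply_path {E : Type*} [NormedAddCommGroup E]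
    [NormedSpace ℝ E] {f : E → ℝ} (hf : ContDiff ℝ 1 f) {s : Set ℝ} {γ v : ℝ → E}
    (hγ : ContinuousOn γ s) (hv : ContinuousOn v s) :
    ContinuousOn (fun t => fderiv ℝ f (γ t) (v t)) s :=
  ((hf.continuous_fderiv one_ne_zero).comp_continuousOn hγ).clm_apply hv

/-- Fundamental theorem of calculus for a `C¹` function along a `C¹` path. -/
theorem ContDiff.integral_fderiv_apply_path {E : Type*} [NormedAddCommGroup E]
    [NormedSpace ℝ E] {f : E → ℝ} (hf : ContDiff ℝ 1 f) {a b : ℝ} (hab : a ≤ b)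
    {γ γ' : ℝ → E} (hγ : ∀ t ∈ Icc a b, HasDerivWithinAt γ (γ' t) (Icc a b) t)
    (hγ' : ContinuousOn γ' (Icc a b)) :
    ∫ t in a..b, fderiv ℝ f (γ t) (γ' t) = f (γ b) - f (γ a) := by
  have hγc : ContinuousOn γ (Icc a b) := fun t ht => (hγ t ht).continuousWithinAt
  refine intervalIntegral.integral_eq_sub_of_hasDerivAt_of_le (f := fun t => f (γ t)) hab
    (hf.continuous.comp_continuousOn hγc) (fun t ht => ?_)
    ((hf.continuousOn_fderiv_apply_path hγc hγ').intervalIntegrable_of_Icc hab)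
  exact ((hf.differentiable one_ne_zero (γ t)).hasFDerivAt.comp_hasDerivAt t
    ((hγ t (Ioo_subset_Icc_self ht)).hasDerivAt (Icc_mem_nhds ht.1 ht.2)))

/-- Exponential reweighting: averaging `exp (β (H₁ - H₀))` over the normalized Gibbs density of
`H₁` yields the ratio of the partition functions. -/
theorem lintegral_exp_sub_withDensity_gibbs {α : Type*} [MeasurableSpace α] {μ : Measure α}
    {β Z : ℝ} {H₀ H₁ : α → ℝ} (hH₀ : Measurable H₀) (hH₁ : Measurable H₁) (hZ : 0 < Z)
    (hint : Integrable (fun x => Real.exp (-β * H₀ x)) μ) :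
    ∫⁻ x, ENNReal.ofReal (Real.exp (β * (H₁ x - H₀ x)))
        ∂μ.withDensity (fun x => ENNReal.ofReal (Real.exp (-β * H₁ x) / Z))
      = ENNReal.ofReal ((∫ x, Real.exp (-β * H₀ x) ∂μ) / Z) := by
  rw [lintegral_withDensity_eq_lintegral_mul _ (by fun_prop) (by fun_prop),
    ← integral_div, ofReal_integral_eq_lintegral_ofReal (hint.div_const Z)
      (ae_of_all _ fun x => by positivity)]
  refine lintegral_congr fun x => ?_
  rw [Pi.mul_apply, ← ENNReal.ofReal_mul (by positivity), div_mul_eq_mul_div, ← Real.exp_add]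
  ring_nf

/-- **Heat–work–feedback representation of the endpoint equality,
positive-exponent form (Eq. (46)).**
Under the smooth endpoint setup on `ℝⁿ` (Gibbs endpoints of a `C¹` HMF
`H* : ℝⁿ × ℝ × ℝ → ℝ` with respect to Lebesgue measure) and the pathwise
trajectory hypothesis (a family of `C¹` trajectories whose endpoint map
pushes `P₀` forward to the density `p₁`), the Lebesgue integral of
`exp (+β [W* + Q* - II*])` over initial conditions equals `exp (+β ΔF*)`;
in particular the left-hand side is finite. -/
theorem heat_work_feedback_endpoint_equality_pos
    (n : ℕ) (hn : 1 ≤ n)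
    (β : ℝ) (hβ : 0 < β)
    (teq : ℝ) (hteq : 0 < teq)
    (Hstar : EuclideanSpace ℝ (Fin n) × ℝ × ℝ → ℝ)
    (hHstar : ContDiff ℝ 1 Hstar)
    (lam lam' C C' : ℝ → ℝ)
    (hlam : ∀ t ∈ Icc (0:ℝ) teq, HasDerivWithinAt lam (lam' t) (Icc (0:ℝ) teq) t)
    (hlam' : ContinuousOn lam' (Icc (0:ℝ) teq))
    (hC : ∀ t ∈ Icc (0:ℝ) teq, HasDerivWithinAt C (C' t) (Icc (0:ℝ) teq) t)
    (hC' : ContinuousOn C' (Icc (0:ℝ) teq))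
    (H0 H1 : EuclideanSpace ℝ (Fin n) → ℝ)
    (hH0 : H0 = fun x => Hstar (x, lam 0, C 0))
    (hH1 : H1 = fun x => Hstar (x, lam teq, C teq))
    (Z0 Z1 : ℝ)
    (hZ0int : Integrable (fun x => Real.exp (-β * H0 x)) volume)
    (hZ1int : Integrable (fun x => Real.exp (-β * H1 x)) volume)
    (hZ0 : Z0 = ∫ x, Real.exp (-β * H0 x))
    (hZ1 : Z1 = ∫ x, Real.exp (-β * H1 x))
    (hZ0pos : 0 < Z0) (hZ1pos : 0 < Z1)
    (p0 p1 : EuclideanSpace ℝ (Fin n) → ℝ)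
    (hp0 : p0 = fun x => Real.exp (-β * H0 x) / Z0)
    (hp1 : p1 = fun x => Real.exp (-β * H1 x) / Z1)
    (ΔF : ℝ) (hΔF : ΔF = -β⁻¹ * Real.log (Z1 / Z0))
    {Γ₀ : Type*} [MeasurableSpace Γ₀] (P₀ : Measure Γ₀) [IsProbabilityMeasure P₀]
    (X : Γ₀ → ℝ → EuclideanSpace ℝ (Fin n))
    (X' : Γ₀ → ℝ → EuclideanSpace ℝ (Fin n))
    (hX : ∀ x₀, ∀ t ∈ Icc (0:ℝ) teq,
      HasDerivWithinAt (X x₀) (X' x₀ t) (Icc (0:ℝ) teq) t)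
    (hX' : ∀ x₀, ContinuousOn (X' x₀) (Icc (0:ℝ) teq))
    (T : Γ₀ → EuclideanSpace ℝ (Fin n))
    (hTdef : T = fun x₀ => X x₀ teq)
    (hT : Measurable T)
    (hpush : Measure.map T P₀
      = (volume : Measure (EuclideanSpace ℝ (Fin n))).withDensity
          (fun x => ENNReal.ofReal (p1 x)))
    (W Q II : Γ₀ → ℝ)
    (hW : W = fun x₀ => ∫ t in (0:ℝ)..teq,
      (fderiv ℝ Hstar (X x₀ t, lam t, C t)) (0, lam' t, 0)
        + (fderiv ℝ Hstar (X x₀ t, lam t, C t)) (0, 0, C' t))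
    (hQ : Q = fun x₀ => ∫ t in (0:ℝ)..teq,
      (fderiv ℝ Hstar (X x₀ t, lam t, C t)) (X' x₀ t, 0, 0))
    (hII : II = fun x₀ => ∫ t in (0:ℝ)..teq,
      (fderiv ℝ (fun z => Hstar (z, lam 0, C 0)) (X x₀ t)) (X' x₀ t))
    (hWmeas : Measurable W) (hQmeas : Measurable Q) (hIImeas : Measurable II) :
    ∫⁻ x₀, ENNReal.ofReal (Real.exp (β * (W x₀ + Q x₀ - II x₀))) ∂P₀
      = ENNReal.ofReal (Real.exp (β * ΔF)) := by
  have hX_cont (x₀ : Γ₀) : ContinuousOn (X x₀) (Icc 0 teq) :=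
    fun t ht => (hX x₀ t ht).continuousWithinAt
  have hlam_cont : ContinuousOn lam (Icc 0 teq) := fun t ht => (hlam t ht).continuousWithinAt
  have hC_cont : ContinuousOn C (Icc 0 teq) := fun t ht => (hC t ht).continuousWithinAt
  have hpath (x₀ : Γ₀) : ContinuousOn (fun t => (X x₀ t, lam t, C t)) (Icc 0 teq) :=
    (hX_cont x₀).prodMk (hlam_cont.prodMk hC_cont)
  have hWQ (x₀ : Γ₀) :
      W x₀ + Q x₀ = Hstar (X x₀ teq, lam teq, C teq) - Hstar (X x₀ 0, lam 0, C 0) := by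
    have hintegrable {v : ℝ → EuclideanSpace ℝ (Fin n) × ℝ × ℝ}
        (hv : ContinuousOn v (Icc 0 teq)) : IntervalIntegrable
          (fun t => fderiv ℝ Hstar (X x₀ t, lam t, C t) (v t)) volume 0 teq :=
      (hHstar.continuousOn_fderiv_apply_path (hpath x₀) hv).intervalIntegrable_of_Icc hteq.le
    rw [← hHstar.integral_fderiv_apply_path hteq.le (γ := fun t => (X x₀ t, lam t, C t))
      (γ' := fun t => (X' x₀ t, lam' t, C' t))
      (fun t ht => (hX x₀ t ht).prodMk ((hlam t ht).prodMk (hC t ht)))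
      ((hX' x₀).prodMk (hlam'.prodMk hC')), hW, hQ]
    dsimp only
    rw [← intervalIntegral.integral_add
      ((hintegrable (continuousOn_const.prodMk (hlam'.prodMk continuousOn_const))).add
        (hintegrable (continuousOn_const.prodMk (continuousOn_const.prodMk hC'))))
      (hintegrable ((hX' x₀).prodMk continuousOn_const))]
    refine intervalIntegral.integral_congr fun t _ => ?_
    simp only [← map_add]
    simp
  have hII_eq (x₀ : Γ₀) : II x₀ = H0 (X x₀ teq) - H0 (X x₀ 0) := by
    have hH0_smooth : ContDiff ℝ 1 fun z => Hstar (z, lam 0, C 0) := by fun_prop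
    rw [hII, hH0]
    exact hH0_smooth.integral_fderiv_apply_path hteq.le (hX x₀) (hX' x₀)
  have hH0_meas : Measurable H0 := by
    rw [hH0]
    exact (hHstar.continuous.comp (by fun_prop)).measurable
  have hH1_meas : Measurable H1 := by
    rw [hH1]
    exact (hHstar.continuous.comp (by fun_prop)).measurable
  have hexponent (x₀ : Γ₀) : W x₀ + Q x₀ - II x₀ = H1 (T x₀) - H0 (T x₀) := by
    rw [hWQ, hII_eq, hTdef, hH0, hH1]
    ring
  have hΔF_exp : Real.exp (β * ΔF) = Z0 / Z1 := by
    rw [hΔF, ← mul_assoc, mul_neg, mul_inv_cancel₀ hβ.ne', neg_one_mul, Real.exp_neg,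
      Real.exp_log (div_pos hZ1pos hZ0pos), inv_div]
  simp only [hexponent]
  rw [← lintegral_map (f := fun x => ENNReal.ofReal (Real.exp (β * (H1 x - H0 x))))
    (by fun_prop) hT, hpush, hp1,
    lintegral_exp_sub_withDensity_gibbs hH0_meas hH1_meas hZ1pos hZ0int, hΔF_exp, hZ0]
end

section
/- Under the frozen-driving Gibbs setup and the trajectory-realization hypothesis, the Lebesgue integral (with values in [0,∞]) over initial conditions satisfies ∫_{Γ₀} (M₁(T(x₀))/M₀(T(x₀))) dP₀(x₀) = exp(−β ΔF*) · (1 + χ²(p₁‖p₀)), where both sides may simultaneously equal ∞. (Frozen-driving trajectory equality, negative-exponent form, Corollary 6, Eq. (53).) -/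
open MeasureTheory

/-- The Gibbs weight of a Hamiltonian of mean force is the bare weight times the environment
factor. -/
lemma exp_neg_mul_sub_inv_mul_log {β h M : ℝ} (hβ : β ≠ 0) (hM : 0 < M) :
    Real.exp (-β * (h - β⁻¹ * Real.log M)) = Real.exp (-β * h) * M := by
  rw [show -β * (h - β⁻¹ * Real.log M) = -β * h + Real.log M by field_simp; ring,
    Real.exp_add, Real.exp_log hM]

/-- **Frozen-driving trajectory equality, negative-exponent form
(Corollary 6, Eq. (53)).**
Under the frozen-driving Gibbs setup and the trajectory-realization hypothesis,
the Lebesgue integral over initial conditions of `M₁(T x₀) / M₀(T x₀)` equals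
`exp (-β ΔF*) * (1 + χ²(p₁‖p₀))`, where both sides may simultaneously be `∞`. -/
theorem frozen_driving_trajectory_equality_neg
    {Ω : Type*} [MeasurableSpace Ω] (m : Measure Ω) [SigmaFinite m]
    (β : ℝ) (hβ : 0 < β)
    (HS : Ω → ℝ) (hHS : Measurable HS)
    (M0 M1 : Ω → ℝ) (hM0 : Measurable M0) (hM1 : Measurable M1)
    (hM0pos : ∀ x, 0 < M0 x) (hM1pos : ∀ x, 0 < M1 x)
    (H0 H1 : Ω → ℝ)
    (hH0 : H0 = fun x => HS x - β⁻¹ * Real.log (M0 x))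
    (hH1 : H1 = fun x => HS x - β⁻¹ * Real.log (M1 x))
    (Z0 Z1 : ℝ)
    (hZ0int : Integrable (fun x => Real.exp (-β * H0 x)) m)
    (hZ1int : Integrable (fun x => Real.exp (-β * H1 x)) m)
    (hZ0 : Z0 = ∫ x, Real.exp (-β * H0 x) ∂m)
    (hZ1 : Z1 = ∫ x, Real.exp (-β * H1 x) ∂m)
    (hZ0pos : 0 < Z0) (hZ1pos : 0 < Z1)
    (p0 p1 : Ω → ℝ)
    (hp0 : p0 = fun x => Real.exp (-β * H0 x) / Z0)
    (hp1 : p1 = fun x => Real.exp (-β * H1 x) / Z1)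
    (ΔF : ℝ) (hΔF : ΔF = -β⁻¹ * Real.log (Z1 / Z0))
    {Γ₀ : Type*} [MeasurableSpace Γ₀] (P₀ : Measure Γ₀) [IsProbabilityMeasure P₀]
    (T : Γ₀ → Ω) (hT : Measurable T)
    (hpush : Measure.map T P₀ = m.withDensity (fun x => ENNReal.ofReal (p1 x))) :
    ∫⁻ x₀, ENNReal.ofReal (M1 (T x₀) / M0 (T x₀)) ∂P₀
      = ENNReal.ofReal (Real.exp (-β * ΔF))
        * ∫⁻ x, ENNReal.ofReal (p1 x ^ 2 / p0 x) ∂m := by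
  have hexpF : Real.exp (-β * ΔF) = Z1 / Z0 := by
    rw [hΔF, show -β * (-β⁻¹ * Real.log (Z1 / Z0)) = Real.log (Z1 / Z0) by field_simp,
      Real.exp_log (div_pos hZ1pos hZ0pos)]
  have hp0' (x : Ω) : p0 x = Real.exp (-β * HS x) * M0 x / Z0 := by
    simp only [hp0, hH0, exp_neg_mul_sub_inv_mul_log hβ.ne' (hM0pos x)]
  have hp1' (x : Ω) : p1 x = Real.exp (-β * HS x) * M1 x / Z1 := by
    simp only [hp1, hH1, exp_neg_mul_sub_inv_mul_log hβ.ne' (hM1pos x)]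
  have hp1_meas : Measurable p1 := by
    rw [funext hp1']
    fun_prop
  have hratio : Measurable fun x => ENNReal.ofReal (M1 x / M0 x) := by fun_prop
  rw [← lintegral_map hratio hT, hpush,
    lintegral_withDensity_eq_lintegral_mul _ hp1_meas.ennreal_ofReal hratio,
    ← lintegral_const_mul' _ _ ENNReal.ofReal_ne_top]
  refine lintegral_congr fun x => ?_
  have hp1_nonneg : 0 ≤ p1 x := by
    have := hM1pos x
    rw [hp1']
    positivity
  rw [Pi.mul_apply, ← ENNReal.ofReal_mul hp1_nonneg, ← ENNReal.ofReal_mul (Real.exp_nonneg _),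
    hexpF, hp0', hp1']
  have := (hM0pos x).ne'
  field_simp
end
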